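/- Every maximal nontraceable graph of order 9 has at least 12 edges, and there exists a maximal nontraceable graph of order 9 with exactly 12 edges. -/

import Mathlib

open SimpleGraph

/-- A graph is traceable if it has a Hamiltonian path, i.e. a path containing
all the vertices of the graph. -/
def Traceable {V : Type*} (G : SimpleGraph V) : Prop :=
  ∃ (u v : V) (p : G.Walk u v), p.IsPath ∧ ∀ w, w ∈ p.support

/-- A graph is maximal nontraceable if it is not traceable, but adding any edge
of the complement produces a traceable graph. -/
def MaxNontraceable {V : Type*} (G : SimpleGraph V) : Prop :=
  ¬ Traceable G ∧ ∀ u v : V, u ≠ v → ¬ G.Adj u v → Traceable (G ⊔ SimpleGraph.edge u v)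

/-- A list of vertices that is a Hamiltonian path of `G`. -/
def IsHamList {V : Type*} (G : SimpleGraph V) (l : List V) : Prop :=
  l.Nodup ∧ (∀ w, w ∈ l) ∧ l.IsChain G.Adj

theorem traceable_iff_isHamList {V : Type*} [Nonempty V] {G : SimpleGraph V} :
    Traceable G ↔ ∃ l, IsHamList G l := by
  constructor
  · rintro ⟨u, v, p, hp, h⟩
    exact ⟨p.support, hp.support_nodup, h, p.isChain_adj_support⟩
  · rintro ⟨l, hn, hm, hc⟩
    have hne : l ≠ [] := List.ne_nil_of_mem (hm (Classical.arbitrary V))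
    refine ⟨_, _, SimpleGraph.Walk.ofSupport l hne hc, ?_, ?_⟩
    · rw [SimpleGraph.Walk.isPath_def, SimpleGraph.Walk.support_ofSupport]
      exact hn
    · rw [SimpleGraph.Walk.support_ofSupport]
      exact hm

theorem IsHamList.reverse {V : Type*} {G : SimpleGraph V} {l : List V} (h : IsHamList G l) :
    IsHamList G l.reverse := by
  refine ⟨List.nodup_reverse.2 h.1, fun w => List.mem_reverse.2 (h.2.1 w), ?_⟩
  rw [List.isChain_reverse]
  exact h.2.2.imp fun _ _ hab => hab.symm

theorem IsHamList.comap {V W : Type*} {G : SimpleGraph V} {l : List V} (h : IsHamList G l)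
    (σ : W ≃ V) : IsHamList (G.comap σ) (l.map σ.symm) := by
  refine ⟨h.1.map σ.symm.injective, fun w => List.mem_map.2 ⟨σ w, h.2.1 _, by simp⟩, ?_⟩
  rw [List.isChain_map]
  exact h.2.2.imp fun a b hab => by simpa using hab

theorem Traceable.comap {V W : Type*} [Nonempty V] [Nonempty W] {G : SimpleGraph V}
    (h : Traceable G) (σ : W ≃ V) : Traceable (G.comap σ) := by
  obtain ⟨l, hl⟩ := traceable_iff_isHamList.1 h
  exact traceable_iff_isHamList.2 ⟨_, hl.comap σ⟩

theorem MaxNontraceable.comap {V W : Type*} [Nonempty V] [Nonempty W] {G : SimpleGraph V}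
    (h : MaxNontraceable G) (σ : W ≃ V) : MaxNontraceable (G.comap σ) := by
  refine ⟨fun ht => h.1 ?_, fun u v huv hadj => ?_⟩
  · have := ht.comap σ.symm
    rwa [SimpleGraph.comap_comap, show (σ : W → V) ∘ σ.symm = id from σ.self_comp_symm,
      SimpleGraph.comap_id] at this
  · have := (h.2 (σ u) (σ v) (σ.injective.ne huv) hadj).comap σ
    convert this using 1
    ext a b
    simp [SimpleGraph.edge_adj, σ.injective.eq_iff, σ.injective.ne_iff]

/-- A vertex with at most one neighbour is an end of each Hamiltonian path. -/
theorem IsHamList.end_of_subsingleton {V : Type*} {G : SimpleGraph V} {l : List V}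
    (h : IsHamList G l) {v : V} (hv : ∀ x y, G.Adj v x → G.Adj v y → x = y) :
    l.head? = some v ∨ l.getLast? = some v := by
  obtain ⟨p, s, rfl⟩ := List.append_of_mem (h.2.1 v)
  rcases List.eq_nil_or_concat p with rfl | ⟨p, x, rfl⟩
  · simp
  · rcases s with _ | ⟨y, s⟩
    · simp
    · exfalso
      obtain ⟨hn, -, hc⟩ := h
      simp only [List.concat_eq_append, List.append_assoc, List.cons_append, List.nil_append,
        List.isChain_append_cons_cons, List.isChain_cons_cons] at hc
      have := hv x y hc.2.1.symm hc.2.2.1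
      subst this
      simp [List.nodup_append] at hn

/-- In a traceable graph, some edge leaves each proper nonempty set of vertices. -/
theorem Traceable.exists_adj {V : Type*} {G : SimpleGraph V} (h : Traceable G) {S : Set V}
    {a b : V} (ha : a ∈ S) (hb : b ∉ S) : ∃ x ∈ S, ∃ y ∉ S, G.Adj x y := by
  have : Nonempty V := ⟨a⟩
  obtain ⟨l, -, hm, hc⟩ := traceable_iff_isHamList.1 h
  by_contra! hno
  have hc' : l.IsChain fun x y => (x ∈ S ↔ y ∈ S) := hc.imp fun x y hxy =>
    ⟨fun hx => by_contra fun hy => hno x hx y hy hxy,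
      fun hy => by_contra fun hx => hno y hy x hx hxy.symm⟩
  have : IsTrans V fun x y => (x ∈ S ↔ y ∈ S) := ⟨fun _ _ _ h₁ h₂ => h₁.trans h₂⟩
  rw [List.isChain_iff_pairwise] at hc'
  have : Std.Symm fun x y => (x ∈ S ↔ y ∈ S) := ⟨fun _ _ h => h.symm⟩
  exact hb ((List.Pairwise.forall_of_forall (R := fun x y => (x ∈ S ↔ y ∈ S))
    (fun _ _ => Iff.rfl) hc' (hm a) (hm b)).1 ha)

theorem isChain_of_isChain_sup_edge {V : Type*} {G : SimpleGraph V} {b c : V} {l : List V}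
    (h : l.IsChain (G ⊔ SimpleGraph.edge b c).Adj) (hl : b ∉ l ∨ c ∉ l) : l.IsChain G.Adj := by
  refine h.imp_of_mem_imp fun x y hx hy hxy => ?_
  rw [SimpleGraph.sup_adj, SimpleGraph.edge_adj] at hxy
  rcases hxy with hxy | ⟨⟨rfl, rfl⟩ | ⟨rfl, rfl⟩, -⟩
  · exact hxy
  all_goals tauto

/-- A Hamiltonian path of `G` plus an edge `bc` that starts at a vertex with neighbours
`b` and `c` only can be rerouted within `G`. -/
theorem IsHamList.traceable_of_head {V : Type*} {G : SimpleGraph V} {v b c : V} {s : List V}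
    (hvb : G.Adj v b) (hvc : G.Adj v c) (hv : ∀ x, G.Adj v x → x = b ∨ x = c)
    (h : IsHamList (G ⊔ SimpleGraph.edge b c) (v :: s)) : Traceable G := by
  have : Nonempty V := ⟨v⟩
  rw [traceable_iff_isHamList]
  obtain ⟨hn, hm, hc⟩ := h
  wlog hb : s.head? = some b generalizing b c
  · rcases s with _ | ⟨x, s⟩
    · simpa [hvb.ne'] using hm b
    · rw [SimpleGraph.edge_comm] at hc
      refine this hvc hvb (fun x hx => (hv x hx).symm) hc ?_
      rw [List.isChain_cons_cons, SimpleGraph.sup_adj, SimpleGraph.edge_adj] at hc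
      have hx : G.Adj v x := by
        rcases hc.1 with h | ⟨⟨h, -⟩ | ⟨h, -⟩, -⟩
        · exact h
        · exact absurd h hvc.ne
        · exact absurd h hvb.ne
      rcases hv x hx with rfl | rfl <;> simp_all
  rcases s with _ | ⟨x, s⟩
  · simp at hb
  simp only [List.head?_cons, Option.some.injEq] at hb
  subst hb
  have hbs : x ∉ s := by simp at hn; tauto
  rcases s with _ | ⟨y, s⟩
  · exact ⟨[v, x], hn, hm, by simpa using hvb⟩
  have hys : (y :: s).IsChain G.Adj :=
    isChain_of_isChain_sup_edge (List.isChain_cons_cons.1 (List.isChain_cons_cons.1 hc).2).2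
      (Or.inl hbs)
  by_cases hy : y = c
  · subst hy
    refine ⟨x :: v :: y :: s, ?_, fun w => ?_, ?_⟩
    · simp at hn ⊢; tauto
    · have := hm w; simp at this ⊢; tauto
    · simp only [List.isChain_cons_cons]
      exact ⟨hvb.symm, hvc, hys⟩
  · refine ⟨v :: x :: y :: s, hn, hm, ?_⟩
    simp only [List.isChain_cons_cons] at hc ⊢
    refine ⟨hvb, ?_, hys⟩
    rcases hc.2.1 with h | h
    · exact h
    · rw [SimpleGraph.edge_adj] at h
      rcases h with ⟨⟨-, h⟩ | ⟨-, h⟩, -⟩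
      · exact absurd h hy
      · simp [h] at hbs

/-- The neighbours of a vertex of degree two of a maximal nontraceable graph are adjacent. -/
theorem MaxNontraceable.adj_of_forall_adj {V : Type*} {G : SimpleGraph V}
    (h : MaxNontraceable G) {v b c : V} (hbc : b ≠ c) (hvb : G.Adj v b) (hvc : G.Adj v c)
    (hv : ∀ x, G.Adj v x → x = b ∨ x = c) : G.Adj b c := by
  have : Nonempty V := ⟨v⟩
  by_contra hadj
  obtain ⟨l, hl⟩ := traceable_iff_isHamList.1 (h.2 b c hbc hadj)
  apply h.1
  have key : ∀ x, (G ⊔ SimpleGraph.edge b c).Adj v x → G.Adj v x := by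
    intro x hx
    rw [SimpleGraph.sup_adj, SimpleGraph.edge_adj] at hx
    rcases hx with h | ⟨⟨h, -⟩ | ⟨h, -⟩, -⟩
    · exact h
    · exact absurd h hvb.ne
    · exact absurd h hvc.ne
  obtain ⟨p, s, rfl⟩ := List.append_of_mem (hl.2.1 v)
  rcases List.eq_nil_or_concat p with rfl | ⟨p, x, rfl⟩
  · exact hl.traceable_of_head hvb hvc hv
  rcases s with _ | ⟨y, s⟩
  · have := hl.reverse
    rw [List.reverse_append, List.reverse_singleton, List.singleton_append] at this
    exact this.traceable_of_head hvb hvc hv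
  obtain ⟨hn, hm, hc⟩ := hl
  simp only [List.concat_eq_append, List.append_assoc, List.cons_append, List.nil_append,
    List.isChain_append_cons_cons, List.isChain_cons_cons] at hc hn hm
  have hvx := key x hc.2.1.symm
  have hvy := key y hc.2.2.1
  have hxp : y ∉ p ++ [x] := by
    intro hy
    simp [List.nodup_append] at hn hy
    grind
  have hxs : x ∉ y :: s := by
    intro hy
    simp [List.nodup_append] at hn hy
    grind
  have hxy : x ≠ y := fun e => hxs (by simp [e])
  have : (x = b ∧ y = c) ∨ (x = c ∧ y = b) := by
    rcases hv x hvx with rfl | rfl <;> rcases hv y hvy with rfl | rfl <;> simp_all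
  refine traceable_iff_isHamList.2 ⟨p ++ x :: v :: y :: s, hn, hm, ?_⟩
  simp only [List.isChain_append_cons_cons, List.isChain_cons_cons]
  refine ⟨isChain_of_isChain_sup_edge hc.1 ?_, hvx.symm, hvy,
    isChain_of_isChain_sup_edge hc.2.2.2 ?_⟩ <;> rcases this with ⟨rfl, rfl⟩ | ⟨rfl, rfl⟩ <;> tauto

/-- `f n`, written so that the kernel evaluates `n` to a literal first. The functions below are
built from `Nat.rec` and the accelerated operations on `Nat` for evaluation by the kernel. -/
noncomputable def force {α : Type} (n : ℕ) (f : ℕ → α) : α :=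
  Nat.rec (f 0) (fun m _ => f (Nat.succ m)) n

/-- The binary digit of `m` with index `i`. -/
noncomputable def bit (m i : ℕ) : ℕ := Nat.land (Nat.shiftRight m i) 1

/-- Whether `p` holds for some number below `n`. -/
noncomputable def anyBelow (n : ℕ) (p : ℕ → Bool) : Bool :=
  Nat.rec false (fun i b => cond (p i) true b) n

/-- Whether `p` holds for all numbers below `n`. -/
noncomputable def allBelow (n : ℕ) (p : ℕ → Bool) : Bool :=
  Nat.rec true (fun i b => cond (p i) b false) n

/-- The number of binary digits `1` of `m < 2 ^ 9`. -/
noncomputable def popcount (m : ℕ) : ℕ := Nat.mod (Nat.land (Nat.mul m 134480385) 4581298449) 15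

/-- Row `i` of the adjacency matrix `R`, whose `9` entries are nine consecutive digits. -/
noncomputable def row (R i : ℕ) : ℕ := Nat.land (Nat.shiftRight R (Nat.mul 9 i)) 511

/-- Whether some path starting at `v` visits `n` more vertices, all distinct and in the set
`a`. -/
noncomputable def extendable (R : ℕ) (n : ℕ) : ℕ → ℕ → Bool :=
  Nat.rec (fun _ _ => true) (fun _ f v a => force (Nat.land (row R v) a) fun m =>
    cond (Nat.beq m 0) false <|
    anyBelow 9 fun w => cond (Nat.beq (Nat.land (Nat.shiftRight m w) 1) 0) false <|
      force (Nat.xor a (Nat.pow 2 w)) (f w)) n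

/-- Whether a row has at most one neighbour. -/
noncomputable def isLeaf (r : ℕ) : Bool := Nat.ble (popcount r) 1

/-- Whether the graph with adjacency matrix `R` has a Hamiltonian path. -/
noncomputable def hasHam (R : ℕ) : Bool :=
  anyBelow (cond (isLeaf (row R 0)) 1 9) fun s =>
    extendable R 8 s (Nat.xor 511 (Nat.pow 2 s))

/-- The adjacency matrix after adding the edge `uw`. -/
noncomputable def addEdge (R : ℕ) (u w : ℕ) : ℕ :=
  Nat.lor R (Nat.lor (Nat.pow 2 (Nat.add (Nat.mul 9 u) w)) (Nat.pow 2 (Nat.add (Nat.mul 9 w) u)))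

/-- Whether `R` is certified not to be maximal nontraceable, either by a Hamiltonian path or by
a pair of nonadjacent vertices whose joining does not create one. -/
noncomputable def notMNT (R : ℕ) : Bool :=
  cond (anyBelow 9 fun u => cond (isLeaf (row R u)) false <| anyBelow u fun w =>
    cond (isLeaf (row R w)) false <|
    cond (Nat.beq (bit R (Nat.add (Nat.mul 9 u) w)) 1) false <|
    force (addEdge R u w) fun R' => cond (hasHam R') false true) true (hasHam R)

/-- The first `v` entries of column `v` of the adjacency matrix. -/
noncomputable def column (R v : ℕ) : ℕ :=
  Nat.rec 0 (fun i c => Nat.lor c (Nat.shiftLeft (bit R (Nat.add (Nat.mul 9 i) v)) i)) v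

/-- Whether no edge from vertex `v`, with row `r` and degree `d`, to an earlier vertex lies in no
triangle while one of its ends has degree `2`. -/
noncomputable def triOK (R r d v : ℕ) : Bool :=
  allBelow v fun i =>
    cond (Nat.beq (bit r i) 0) true <| force (row R i) fun s =>
     cond (Nat.beq (Nat.land r s) 0) (cond (Nat.beq d 2) false
       (cond (Nat.beq (popcount s) 2) false true)) true

/-- The maximum of `2` and `d`. -/
noncomputable def max2 (d : ℕ) : ℕ := cond (Nat.ble 2 d) d 2

/-- The part of `step` that prunes by the sum `tot` of `max 2 deg` and by triangles. -/
noncomputable def stepTot (f : ℕ → ℕ → ℕ → ℕ → ℕ → ℕ → Bool)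
    (n v k d₀ lv R r d tot : ℕ) : Bool :=
  cond (Nat.ble (Nat.add tot (Nat.mul n (max2 d₀))) (cond (Nat.ble d₀ 1) 24 22))
    (cond (triOK R r d v)
      (force (Nat.lor R (Nat.shiftLeft r (Nat.mul 9 v))) (f (Nat.succ v) k d₀ tot lv)) true) true

/-- The part of `step` that prunes by the number `lv` of leaves. -/
noncomputable def stepLv (f : ℕ → ℕ → ℕ → ℕ → ℕ → ℕ → Bool)
    (n v k d₀ tot R r d lv : ℕ) : Bool :=
  cond (Nat.ble lv 2) (force (Nat.add tot (max2 d)) (stepTot f n v k d₀ lv R r d)) true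

/-- The part of `step` that prunes by the degree `d₀` of vertex `0`, which is to be minimal. -/
noncomputable def stepD0 (f : ℕ → ℕ → ℕ → ℕ → ℕ → ℕ → Bool)
    (n v k tot lv R r d d₀ : ℕ) : Bool :=
  cond (Nat.ble d₀ d)
    (force (cond (Nat.ble d 1) (Nat.succ lv) lv) (stepLv f n v k d₀ tot R r d)) true

/-- The part of `step` that follows the computation of the degree of `v`. -/
noncomputable def stepD (f : ℕ → ℕ → ℕ → ℕ → ℕ → ℕ → Bool)
    (n v k d₀ tot lv R r d : ℕ) : Bool :=
   force (cond (Nat.beq v 0) d d₀) (stepD0 f n v k tot lv R r d)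

/-- Add the row `r` of vertex `v` and continue with `f` unless the new state can be pruned; `n`
rows remain after it. -/
noncomputable def step (f : ℕ → ℕ → ℕ → ℕ → ℕ → ℕ → Bool)
    (n v k d₀ tot lv R r : ℕ) : Bool :=
   force (popcount r) (stepD f n v k d₀ tot lv R r)

/-- Whether `f` succeeds at all unpruned states that are obtained by choosing `n` more rows, for
the vertices from `v` on. The vertices from `k` on are still interchangeable, so those of them
which are adjacent to `v` may be taken to come first. -/
noncomputable def search (f : ℕ → ℕ → ℕ → ℕ → ℕ → ℕ → Bool) (n : ℕ) :
    ℕ → ℕ → ℕ → ℕ → ℕ → ℕ → Bool :=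
  Nat.rec f (fun _ g v k d₀ tot lv R =>
    cond (Nat.beq v k) true <| force (column R v) fun low => force (Nat.sub 8 v) fun n =>
    allBelow (Nat.sub 10 k) fun t => force (Nat.add k t) fun k' =>
    force (Nat.lor low (Nat.shiftLeft (Nat.pred (Nat.pow 2 t)) k)) fun low' =>
    allBelow (Nat.pow 2 (Nat.sub k (Nat.succ v))) fun S =>
      force (Nat.lor low' (Nat.shiftLeft S (Nat.succ v))) (step g n v k' d₀ tot lv R)) n

/-- The search for the last six rows below the states whose code is `i` modulo `23`. -/
noncomputable def searchPart (i v k d₀ tot lv R : ℕ) : Bool :=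
  cond (Nat.beq (Nat.mod R 23) i) (search (fun _ _ _ _ _ R => notMNT R) 6 v k d₀ tot lv R) true

@[simp] theorem force_eq {α : Type} (n : ℕ) (f : ℕ → α) : force n f = f n := by
  cases n <;> rfl

@[simp] theorem anyBelow_eq_true {n : ℕ} {p : ℕ → Bool} :
    anyBelow n p = true ↔ ∃ i < n, p i = true := by
  induction n with
  | zero => simp [anyBelow]
  | succ n ih =>
    change (cond (p n) true (anyBelow n p)) = true ↔ _
    rw [Nat.exists_lt_succ_right, ← ih]
    cases p n <;> simp

@[simp] theorem allBelow_eq_true {n : ℕ} {p : ℕ → Bool} :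
    allBelow n p = true ↔ ∀ i < n, p i = true := by
  induction n with
  | zero => simp [allBelow]
  | succ n ih =>
    change (cond (p n) (allBelow n p) false) = true ↔ _
    rw [Nat.forall_lt_succ_right, ← ih]
    cases p n <;> simp

@[simp] theorem bit_eq (m i : ℕ) : bit m i = (m.testBit i).toNat := by
  change (m >>> i) &&& 1 = _
  rw [Nat.and_one_is_mod, Nat.testBit_eq_decide_div_mod_eq, Nat.shiftRight_eq_div_pow]
  rcases Nat.mod_two_eq_zero_or_one (m / 2 ^ i) with h | h <;> simp [h]

@[simp] theorem testBit_row (R i j : ℕ) :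
    (row R i).testBit j = (R.testBit (9 * i + j) && decide (j < 9)) := by
  change ((R >>> (9 * i)) &&& 2 ^ 9 - 1).testBit j = _
  rw [Nat.testBit_and, Nat.testBit_shiftRight, Nat.testBit_two_pow_sub_one]

theorem row_lt (R i : ℕ) : row R i < 512 :=
  lt_of_le_of_lt (Nat.and_le_right : (R >>> (9 * i)) &&& 511 ≤ 511) (by norm_num)

theorem popcount_eq {m : ℕ} (hm : m < 512) :
    popcount m = ((Finset.range 9).filter fun j => m.testBit j).card := by
  have h : allBelow 512 (fun m => Nat.beq (popcount m) (Nat.rec 0 (fun j c => Nat.add c (bit m j)) 9)) =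
      true := by
    decide +kernel
  rw [allBelow_eq_true] at h
  rw [Nat.eq_of_beq_eq_true (h m hm), Finset.card_filter]
  have (n : ℕ) : (Nat.rec 0 (fun j c => Nat.add c (bit m j)) n : ℕ) =
      ∑ j ∈ Finset.range n, if m.testBit j = true then 1 else 0 := by
    induction n with
    | zero => rfl
    | succ n ih =>
      rw [Finset.sum_range_succ, ← ih, ← Bool.cond_eq_ite]
      exact congrArg _ (bit_eq m n)
  exact this 9

theorem extendable_eq_true {R n v a : ℕ} : extendable R n v a = true ↔
    ∃ l : List ℕ, l.length = n ∧ (v :: l).IsChain (fun i j => (row R i).testBit j = true) ∧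
      l.Nodup ∧ ∀ x ∈ l, x < 9 ∧ a.testBit x = true := by
  induction n generalizing v a with
  | zero =>
    refine iff_of_true rfl ⟨[], by simp⟩
  | succ n ih =>
    have hstep : extendable R (n + 1) v a = true ↔ ∃ w < 9, (row R v).testBit w = true ∧
        a.testBit w = true ∧ extendable R n w (a ^^^ 2 ^ w) = true := by
      change force (Nat.land (row R v) a) (fun m => cond (Nat.beq m 0) false (anyBelow 9 fun w =>
        cond (Nat.beq (bit m w) 0) false
          (force (Nat.xor a (Nat.pow 2 w)) (extendable R n w)))) = true ↔ _
      have h0 (w : ℕ) : (row R v &&& a).testBit w = true ↔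
          (row R v).testBit w = true ∧ a.testBit w = true := by simp [Nat.testBit_and]
      rw [force_eq]
      change (cond (Nat.beq (row R v &&& a) 0) false (anyBelow 9 fun w =>
        cond (Nat.beq (bit (row R v &&& a) w) 0) false
          (force (a ^^^ 2 ^ w) (extendable R n w)))) = true ↔ _
      generalize row R v &&& a = m at h0
      simp only [force_eq, bit_eq, ← and_assoc, ← h0]
      by_cases hm : m = 0
      · subst hm
        simp
      · have : Nat.beq m 0 = false := Bool.eq_false_iff.2 (mt Nat.eq_of_beq_eq_true hm)
        rw [this, cond_false, anyBelow_eq_true]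
        refine exists_congr fun w => ?_
        cases m.testBit w <;> simp [show Nat.beq 1 0 = false from rfl]
    rw [hstep]
    constructor
    · rintro ⟨w, hw, hvw, haw, h⟩
      obtain ⟨l, hl, hc, hn, hm⟩ := ih.1 h
      refine ⟨w :: l, by simp [hl], List.isChain_cons_cons.2 ⟨hvw, hc⟩, ?_, ?_⟩
      · refine List.nodup_cons.2 ⟨fun hwl => ?_, hn⟩
        have := (hm w hwl).2
        simp [Nat.testBit_xor, haw] at this
      · intro x hx
        rcases List.mem_cons.1 hx with rfl | hx
        · exact ⟨hw, haw⟩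
        · refine ⟨(hm x hx).1, ?_⟩
          have := (hm x hx).2
          by_cases hxw : w = x
          · exact hxw ▸ haw
          · simpa [Nat.testBit_xor, Nat.testBit_two_pow, hxw] using this
    · rintro ⟨_ | ⟨w, l⟩, hl, hc, hn, hm⟩
      · simp at hl
      rw [List.isChain_cons_cons] at hc
      rw [List.nodup_cons] at hn
      refine ⟨w, (hm w (by simp)).1, hc.1, (hm w (by simp)).2, ih.2 ⟨l, by simpa using hl, hc.2,
        hn.2, fun x hx => ⟨(hm x (by simp [hx])).1, ?_⟩⟩⟩
      have hxw : w ≠ x := fun h => hn.1 (h ▸ hx)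
      simpa [Nat.testBit_xor, Nat.testBit_two_pow, hxw] using (hm x (by simp [hx])).2

/-- Adjacency of the vertices numbered `i` and `j`, for arbitrary natural numbers. -/
def AdjNat (H : SimpleGraph (Fin 9)) (i j : ℕ) : Prop :=
  ∃ (hi : i < 9) (hj : j < 9), H.Adj ⟨i, hi⟩ ⟨j, hj⟩

@[simp] theorem adjNat_val {H : SimpleGraph (Fin 9)} {i j : Fin 9} :
    AdjNat H i j ↔ H.Adj i j := ⟨fun ⟨_, _, h⟩ => h, fun h => ⟨i.2, j.2, h⟩⟩

theorem AdjNat.symm {H : SimpleGraph (Fin 9)} {i j : ℕ} (h : AdjNat H i j) : AdjNat H j i :=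
  ⟨h.2.1, h.1, h.2.2.symm⟩

theorem AdjNat.ne {H : SimpleGraph (Fin 9)} {i j : ℕ} (h : AdjNat H i j) : i ≠ j := by
  rintro rfl
  exact h.2.2.ne rfl

/-- The binary digits of `R` are the first `v` rows of the adjacency matrix of `H`,
followed by zeros. -/
def Codes (R v : ℕ) (H : SimpleGraph (Fin 9)) : Prop :=
  ∀ i j, j < 9 → (R.testBit (9 * i + j) = true ↔ i < v ∧ AdjNat H i j)

theorem Codes.testBit_row {R v : ℕ} {H : SimpleGraph (Fin 9)} (h : Codes R v H) {i j : ℕ} :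
    (row R i).testBit j = true ↔ i < v ∧ AdjNat H i j := by
  rw [_root_.testBit_row, Bool.and_eq_true, decide_eq_true_eq]
  constructor
  · rintro ⟨h₁, h₂⟩
    exact (h i j h₂).1 h₁
  · rintro ⟨h₁, h₂⟩
    exact ⟨(h i j h₂.2.1).2 ⟨h₁, h₂⟩, h₂.2.1⟩

theorem popcount_eq_ncard {H : SimpleGraph (Fin 9)} {i : Fin 9} {r : ℕ} (hr : r < 512)
    (h : ∀ j, r.testBit j = true ↔ AdjNat H i j) : popcount r = (H.neighborSet i).ncard := by
  rw [popcount_eq hr, ← Set.ncard_coe_finset, ← Set.ncard_image_of_injective _ Fin.val_injective]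
  congr 1
  ext j
  simp only [Finset.coe_filter, Finset.mem_range, h, Set.mem_ofPred_eq, Set.mem_image,
    SimpleGraph.mem_neighborSet]
  constructor
  · rintro ⟨-, _, hj, h⟩
    exact ⟨⟨j, hj⟩, h, rfl⟩
  · rintro ⟨j, h, rfl⟩
    exact ⟨j.2, adjNat_val.2 h⟩

theorem Codes.popcount_row {R v : ℕ} {H : SimpleGraph (Fin 9)} (h : Codes R v H) {i : Fin 9}
    (hi : i < v) : popcount (row R i) = (H.neighborSet i).ncard :=
  popcount_eq_ncard (row_lt R i) fun j => by rw [h.testBit_row]; simp [hi]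

theorem Codes.isLeaf_row {R v : ℕ} {H : SimpleGraph (Fin 9)} (h : Codes R v H) {i : Fin 9}
    (hi : i < v) : isLeaf (row R i) = true ↔ (H.neighborSet i).ncard ≤ 1 := by
  rw [← h.popcount_row hi, isLeaf, Nat.ble_eq]

theorem Codes.hasHam_eq_true {R : ℕ} {H : SimpleGraph (Fin 9)} (h : Codes R 9 H) :
    hasHam R = true ↔ Traceable H := by
  rw [traceable_iff_isHamList]
  have hrow (i j : ℕ) : (row R i).testBit j = true ↔ AdjNat H i j := by
    rw [h.testBit_row]
    exact ⟨fun h => h.2, fun h => ⟨h.1, h⟩⟩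
  have h511 (s x : ℕ) : (511 ^^^ 2 ^ s).testBit x = true ↔ ((x < 9) ↔ x ≠ s) := by
    rw [show 511 = 2 ^ 9 - 1 by rfl, Nat.testBit_xor, Nat.testBit_two_pow_sub_one,
      Nat.testBit_two_pow]
    by_cases h₁ : x < 9 <;> by_cases h₂ : s = x <;> simp [h₁, h₂, eq_comm]
  have hext (s : ℕ) : extendable R 8 s (511 ^^^ 2 ^ s) = true ↔ ∃ l : List ℕ, l.length = 8 ∧
      (s :: l).IsChain (AdjNat H) ∧ (s :: l).Nodup ∧ ∀ x ∈ l, x < 9 := by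
    simp only [extendable_eq_true, hrow, h511, List.nodup_cons]
    refine exists_congr fun l => and_congr_right fun _ => and_congr_right fun _ => ?_
    constructor
    · rintro ⟨h₁, h₂⟩
      refine ⟨⟨fun hs => ?_, h₁⟩, fun x hx => (h₂ x hx).1⟩
      have := h₂ s hs
      tauto
    · rintro ⟨⟨h₁, h₂⟩, h₃⟩
      refine ⟨h₂, fun x hx => ⟨h₃ x hx, iff_of_true (h₃ x hx) ?_⟩⟩
      rintro rfl
      exact h₁ hx
  have hmk (s : Fin 9) (l : List (Fin 9)) (hl : IsHamList H (s :: l)) :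
      extendable R 8 s (511 ^^^ 2 ^ (s : ℕ)) = true := by
    rw [hext]
    refine ⟨l.map Fin.val, ?_, ?_, ?_, by simp⟩
    · have hf : (s :: l).toFinset = Finset.univ := by
        ext x
        simpa using hl.2.1 x
      have := List.toFinset_card_of_nodup hl.1
      rw [hf] at this
      simpa using this.symm
    · rw [← List.map_cons, List.isChain_map]
      exact hl.2.2.imp fun _ _ => adjNat_val.2
    · rw [← List.map_cons]
      exact hl.1.map Fin.val_injective
  constructor
  · intro hR
    have hR : anyBelow (cond (isLeaf (row R 0)) 1 9)
      (fun s => extendable R 8 s (511 ^^^ 2 ^ s)) = true := hR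
    rw [anyBelow_eq_true] at hR
    obtain ⟨s, hs, hR⟩ := hR
    have hs : s < 9 := by
      cases hb : isLeaf (row R 0) <;> rw [hb] at hs
      exacts [hs, hs.trans (by norm_num)]
    obtain ⟨l, hl, hc, hn, hm⟩ := (hext s).1 hR
    have hm' : ∀ x ∈ s :: l, x < 9 := by simpa [hs] using hm
    have hn' : ((s :: l).map (Fin.ofNat 9)).Nodup := by
      refine hn.map_on fun x hx y hy hxy => ?_
      have := congrArg Fin.val hxy
      simpa [Nat.mod_eq_of_lt (hm' x hx), Nat.mod_eq_of_lt (hm' y hy)] using this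
    refine ⟨_, hn', fun w => ?_, ?_⟩
    · have := List.toFinset_card_of_nodup hn'
      have : ((s :: l).map (Fin.ofNat 9)).toFinset = Finset.univ := by
        rw [← Finset.card_eq_iff_eq_univ, this]
        simp [hl]
      rw [← List.mem_toFinset, this]
      exact Finset.mem_univ w
    · rw [List.isChain_map]
      refine hc.imp fun i j hij => ?_
      obtain ⟨hi, hj, hij⟩ := hij
      rwa [show Fin.ofNat 9 i = ⟨i, hi⟩ from Fin.ext (Nat.mod_eq_of_lt hi),
        show Fin.ofNat 9 j = ⟨j, hj⟩ from Fin.ext (Nat.mod_eq_of_lt hj)]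
  · rintro ⟨l, hl⟩
    change anyBelow (cond (isLeaf (row R 0)) 1 9)
      (fun s => extendable R 8 s (511 ^^^ 2 ^ s)) = true
    rw [anyBelow_eq_true]
    have hne : l ≠ [] := List.ne_nil_of_mem (hl.2.1 0)
    by_cases h0 : isLeaf (row R 0) = true
    · rw [h0]
      suffices ∃ l : List (Fin 9), IsHamList H (0 :: l) by
        obtain ⟨l, hl⟩ := this
        exact ⟨0, by simp, hmk 0 l hl⟩
      have h0' := (h.isLeaf_row (i := 0) (by simp)).1 h0
      rw [Set.ncard_le_one_iff] at h0'
      rcases hl.end_of_subsingleton (v := 0) fun x y hx hy => h0' hx hy with h | h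
      · rw [List.head?_eq_some_iff] at h
        obtain ⟨l, rfl⟩ := h
        exact ⟨_, hl⟩
      · rw [List.getLast?_eq_some_iff] at h
        obtain ⟨l, rfl⟩ := h
        have := hl.reverse
        simp only [List.reverse_append, List.reverse_cons, List.reverse_nil, List.nil_append,
          List.singleton_append] at this
        exact ⟨_, this⟩
    · rcases l with _ | ⟨s, l⟩
      · exact absurd rfl hne
      · exact ⟨s, by simp [h0], hmk s l hl⟩

theorem Codes.addEdge {R : ℕ} {H : SimpleGraph (Fin 9)} (h : Codes R 9 H) {u w : Fin 9}
    (huw : u ≠ w) : Codes (addEdge R u w) 9 (H ⊔ SimpleGraph.edge u w) := by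
  intro i j hj
  change (R ||| (2 ^ (9 * u.val + w) ||| 2 ^ (9 * w.val + u))).testBit _ = true ↔ _
  simp only [Nat.testBit_or, Nat.testBit_two_pow, Bool.or_eq_true, h i j hj, decide_eq_true_eq]
  unfold AdjNat
  simp only [SimpleGraph.sup_adj, SimpleGraph.edge_adj, Fin.ext_iff]
  constructor
  · rintro (⟨h₁, h₂, h₃, h₄⟩ | h₁ | h₁)
    · exact ⟨h₁, h₂, h₃, Or.inl h₄⟩
    · obtain ⟨rfl, rfl⟩ : i = u ∧ j = w := by omega
      exact ⟨u.2, u.2, hj, Or.inr ⟨by simp, by simpa [Fin.ext_iff] using huw⟩⟩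
    · obtain ⟨rfl, rfl⟩ : i = w ∧ j = u := by omega
      exact ⟨w.2, w.2, hj, Or.inr ⟨by simp, by simpa [Fin.ext_iff] using huw.symm⟩⟩
  · rintro ⟨h₁, h₂, h₃, h₄ | h₄⟩
    · exact Or.inl ⟨h₁, h₂, h₃, h₄⟩
    · right
      omega

theorem cond_true_left_eq_true {b c : Bool} : cond b true c = true ↔ b = true ∨ c = true := by
  cases b <;> simp

theorem cond_false_left_eq_true {b c : Bool} :
    cond b false c = true ↔ b = false ∧ c = true := by
  cases b <;> simp

theorem cond_true_right_eq_true {b c : Bool} :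
    cond b c true = true ↔ (b = true → c = true) := by
  cases b <;> simp

theorem Codes.not_maxNontraceable {R : ℕ} {H : SimpleGraph (Fin 9)} (h : Codes R 9 H)
    (hR : notMNT R = true) : ¬ MaxNontraceable H := by
  intro hH
  unfold notMNT at hR
  simp only [cond_true_left_eq_true, anyBelow_eq_true, cond_false_left_eq_true, force_eq] at hR
  rcases hR with ⟨u, hu, -, w, hw, -, hadj, hR, -⟩ | hR
  · have huw : (⟨u, hu⟩ : Fin 9) ≠ ⟨w, hw.trans hu⟩ := by simp; omega
    refine Bool.eq_false_iff.1 hR (((h.addEdge huw).hasHam_eq_true).2 (hH.2 _ _ huw ?_))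
    intro hadj'
    have := (h u w (hw.trans hu)).2 ⟨hu, hu, hw.trans hu, hadj'⟩
    rw [bit_eq, show Nat.add (Nat.mul 9 u) w = 9 * u + w from rfl, this] at hadj
    cases hadj
  · exact hH.1 (h.hasHam_eq_true.1 hR)

theorem MaxNontraceable.adj_of_same_side {H : SimpleGraph (Fin 9)} (h : MaxNontraceable H)
    {p : Fin 9 → Prop} {a b : Fin 9} (ha : p a) (hb : ¬ p b)
    (hp : ∀ i j, p i → ¬ p j → ¬ H.Adj i j) {x y : Fin 9} (hxy : x ≠ y) (hpxy : p x ↔ p y) :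
    H.Adj x y := by
  by_contra hadj
  obtain ⟨i, hi, j, hj, hij⟩ := (h.2 x y hxy hadj).exists_adj (S := {i | p i}) ha hb
  rw [SimpleGraph.sup_adj, SimpleGraph.edge_adj] at hij
  rcases hij with hij | ⟨⟨rfl, rfl⟩ | ⟨rfl, rfl⟩, -⟩
  · exact hp i j hi hj hij
  · exact hj (hpxy.1 hi)
  · exact hj (hpxy.2 hi)

theorem card_mul_le_sum_ncard_neighborSet {V : Type*} [Finite V] {G : SimpleGraph V}
    {T : Finset V} (hT : ∀ x ∈ T, ∀ y ∈ T, x ≠ y → G.Adj x y) :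
    T.card * (T.card - 1) ≤ ∑ i ∈ T, (G.neighborSet i).ncard := by
  classical
  rw [← smul_eq_mul]
  refine Finset.card_nsmul_le_sum T _ _ fun i hi => ?_
  rw [← Finset.card_erase_of_mem hi, ← Set.ncard_coe_finset]
  refine Set.ncard_le_ncard (fun j hj => ?_) (Set.toFinite _)
  have hj : j ∈ T.erase i := hj
  rw [Finset.mem_erase] at hj
  exact hT i hi j hj.2 hj.1.symm

theorem not_isHamList_of_three_leaves {V : Type*} {G : SimpleGraph V} {l : List V}
    {a b c : V} (hab : a ≠ b) (hac : a ≠ c) (hbc : b ≠ c)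
    (ha : ∀ x y, G.Adj a x → G.Adj a y → x = y) (hb : ∀ x y, G.Adj b x → G.Adj b y → x = y)
    (hc : ∀ x y, G.Adj c x → G.Adj c y → x = y) : ¬ IsHamList G l := by
  intro h
  have h₁ := h.end_of_subsingleton ha
  have h₂ := h.end_of_subsingleton hb
  have h₃ := h.end_of_subsingleton hc
  grind

theorem MaxNontraceable.adj_of_three_leaves {V : Type*} {G : SimpleGraph V}
    (h : MaxNontraceable G) {a b c : V} (hab : a ≠ b) (hac : a ≠ c) (hbc : b ≠ c)
    (ha : ∀ x y, G.Adj a x → G.Adj a y → x = y) (hb : ∀ x y, G.Adj b x → G.Adj b y → x = y)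
    (hc : ∀ x y, G.Adj c x → G.Adj c y → x = y) {u v : V} (huv : u ≠ v)
    (hu : u ≠ a ∧ u ≠ b ∧ u ≠ c) (hv : v ≠ a ∧ v ≠ b ∧ v ≠ c) : G.Adj u v := by
  have : Nonempty V := ⟨a⟩
  by_contra hadj
  obtain ⟨l, hl⟩ := traceable_iff_isHamList.1 (h.2 u v huv hadj)
  have key {z : V} (hz : ∀ x y, G.Adj z x → G.Adj z y → x = y) (hzu : u ≠ z) (hzv : v ≠ z)
      (x y : V) (hx : (G ⊔ SimpleGraph.edge u v).Adj z x)
      (hy : (G ⊔ SimpleGraph.edge u v).Adj z y) : x = y := by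
    simp only [SimpleGraph.sup_adj, SimpleGraph.edge_adj] at hx hy
    grind
  exact not_isHamList_of_three_leaves hab hac hbc (key ha hu.1 hv.1) (key hb hu.2.1 hv.2.1)
    (key hc hu.2.2 hv.2.2) hl

theorem MaxNontraceable.exists_common_neighbor {V : Type*} {G : SimpleGraph V}
    (h : MaxNontraceable G) {a b : V} (hab : G.Adj a b) (ha : (G.neighborSet a).ncard = 2) :
    ∃ c, G.Adj a c ∧ G.Adj b c := by
  obtain ⟨x, y, hxy, hn⟩ := Set.ncard_eq_two.1 ha
  have hmem (z : V) : G.Adj a z ↔ z = x ∨ z = y := by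
    rw [← SimpleGraph.mem_neighborSet, hn]
    simp
  have hadj := h.adj_of_forall_adj hxy ((hmem x).2 (Or.inl rfl)) ((hmem y).2 (Or.inr rfl))
    fun z hz => (hmem z).1 hz
  rcases (hmem b).1 hab with rfl | rfl
  · exact ⟨y, (hmem y).2 (Or.inr rfl), hadj⟩
  · exact ⟨x, (hmem x).2 (Or.inl rfl), hadj.symm⟩

/-- A maximal nontraceable graph with at most eleven edges. -/
def SparseMNT (H : SimpleGraph (Fin 9)) : Prop :=
  MaxNontraceable H ∧ ∑ i, (H.neighborSet i).ncard ≤ 22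

theorem ncard_neighborSet_comap {V W : Type*} (H : SimpleGraph V) (σ : W ≃ V) (i : W) :
    ((H.comap σ).neighborSet i).ncard = (H.neighborSet (σ i)).ncard := by
  rw [← Set.ncard_image_of_injective _ σ.injective]
  congr 1
  ext j
  simp only [Set.mem_image, SimpleGraph.mem_neighborSet, SimpleGraph.comap_adj]
  exact ⟨fun ⟨x, hx, hxj⟩ => hxj ▸ hx, fun hj => ⟨σ.symm j, by simpa using hj, by simp⟩⟩

theorem SparseMNT.comap {H : SimpleGraph (Fin 9)} (h : SparseMNT H) (σ : Equiv.Perm (Fin 9)) :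
    SparseMNT (H.comap σ) := by
  refine ⟨h.1.comap σ, ?_⟩
  simp only [ncard_neighborSet_comap]
  rw [Equiv.sum_comp σ fun i => (H.neighborSet i).ncard]
  exact h.2

theorem SparseMNT.exists_adj {H : SimpleGraph (Fin 9)} (h : SparseMNT H) {T : Finset (Fin 9)}
    {a b : Fin 9} (ha : a ∈ T) (hb : b ∉ T) : ∃ i ∈ T, ∃ j ∉ T, H.Adj i j := by
  by_contra! hno
  have hside {x y : Fin 9} (hxy : x ≠ y) (hT : x ∈ T ↔ y ∈ T) : H.Adj x y :=
    h.1.adj_of_same_side (p := (· ∈ T)) ha hb (fun i j hi hj => hno i hi j hj) hxy hT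
  have h₁ := card_mul_le_sum_ncard_neighborSet (T := T) fun x hx y hy hxy =>
    hside hxy (iff_of_true hx hy)
  have h₂ := card_mul_le_sum_ncard_neighborSet (T := Tᶜ) fun x hx y hy hxy =>
    hside hxy (iff_of_false (Finset.mem_compl.1 hx) (Finset.mem_compl.1 hy))
  have hcard := T.card_add_card_compl
  have hsum := T.sum_add_sum_compl fun i => (H.neighborSet i).ncard
  have hle := h.2
  rw [Fintype.card_fin] at hcard
  rw [show Tᶜ.card = 9 - T.card by omega] at h₂
  generalize T.card = m at *
  have : m ≤ 9 := by omega
  interval_cases m <;> omega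

theorem SparseMNT.one_le_ncard {H : SimpleGraph (Fin 9)} (h : SparseMNT H) (i : Fin 9) :
    1 ≤ (H.neighborSet i).ncard := by
  obtain ⟨b, hb⟩ := exists_ne i
  obtain ⟨x, hx, y, -, hxy⟩ := h.exists_adj (Finset.mem_singleton_self i)
    (by rwa [Finset.mem_singleton])
  rw [Finset.mem_singleton] at hx
  subst hx
  exact (Set.ncard_pos (Set.toFinite _)).2 ⟨y, hxy⟩

theorem SparseMNT.card_leaves_le {H : SimpleGraph (Fin 9)} (h : SparseMNT H) :
    (Finset.univ.filter fun i => (H.neighborSet i).ncard ≤ 1).card ≤ 2 := by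
  by_contra! hcard
  obtain ⟨a, b, c, ha, hb, hc, hab, hac, hbc⟩ := Finset.two_lt_card_iff.1 hcard
  simp only [Finset.mem_filter, Finset.mem_univ, true_and] at ha hb hc
  rw [Set.ncard_le_one_iff] at ha hb hc
  have h₁ := card_mul_le_sum_ncard_neighborSet (T := ({a, b, c} : Finset (Fin 9))ᶜ)
    fun x hx y hy hxy => h.1.adj_of_three_leaves hab hac hbc (fun _ _ => ha) (fun _ _ => hb)
      (fun _ _ => hc) hxy (by simpa using hx) (by simpa using hy)
  rw [Finset.card_compl, Finset.card_eq_three.2 ⟨a, b, c, hab, hac, hbc, rfl⟩,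
    Fintype.card_fin] at h₁
  have h₂ := Finset.sum_le_univ_sum_of_nonneg (s := ({a, b, c} : Finset (Fin 9))ᶜ)
    fun i => Nat.zero_le (H.neighborSet i).ncard
  exact absurd (h₁.trans (h₂.trans h.2)) (by norm_num)

theorem SparseMNT.sum_max_le {H : SimpleGraph (Fin 9)} (h : SparseMNT H)
    (h0 : ∀ i, (H.neighborSet 0).ncard ≤ (H.neighborSet i).ncard) :
    ∑ i, max 2 (H.neighborSet i).ncard ≤ if (H.neighborSet 0).ncard ≤ 1 then 24 else 22 := by
  split_ifs with hle
  · calc ∑ i, max 2 (H.neighborSet i).ncard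
        ≤ ∑ i, ((H.neighborSet i).ncard + if (H.neighborSet i).ncard ≤ 1 then 1 else 0) := by
          refine Finset.sum_le_sum fun i _ => ?_
          have := h.one_le_ncard i
          split_ifs <;> omega
      _ ≤ 24 := by
          rw [Finset.sum_add_distrib, ← Finset.card_filter]
          exact Nat.add_le_add h.2 h.card_leaves_le
  · refine le_trans (Finset.sum_le_sum fun i _ => ?_) h.2
    have := h0 i
    omega

/-- The points outside an initial segment can be permuted so that those satisfying `p` come
first. -/
theorem exists_perm_initial (p : Fin 9 → Prop) {k : ℕ} (hk : k ≤ 9) :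
    ∃ (σ : Equiv.Perm (Fin 9)) (t : ℕ), k + t ≤ 9 ∧ (∀ i : Fin 9, i.val < k → σ i = i) ∧
      ∀ i : Fin 9, k ≤ i.val → (p (σ i) ↔ i.val < k + t) := by
  obtain ⟨m, hm⟩ := Nat.exists_eq_add_of_le' hk
  induction m generalizing p k with
  | zero => exact ⟨1, 0, by omega, fun _ _ => rfl, fun i hi => by omega⟩
  | succ m ih =>
    by_cases hp : ∃ x : Fin 9, k ≤ x.val ∧ p x
    · obtain ⟨x, hx, hpx⟩ := hp
      obtain ⟨σ, t, ht, hσ, hσp⟩ := ih (p ∘ Equiv.swap ⟨k, by omega⟩ x) (k := k + 1) (by omega)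
        (by omega)
      refine ⟨Equiv.swap ⟨k, by omega⟩ x * σ, t + 1, by omega, fun i hi => ?_, fun i hi => ?_⟩
      · rw [Equiv.Perm.mul_apply, hσ i (by omega), Equiv.swap_apply_of_ne_of_ne]
        · rintro rfl; simp at hi
        · rintro rfl; omega
      · rw [Equiv.Perm.mul_apply]
        rcases hi.eq_or_lt with hi | hi
        · rw [hσ i (by omega), show i = ⟨k, by omega⟩ from Fin.ext hi.symm,
            Equiv.swap_apply_left]
          simpa using hpx
        · exact (hσp i hi).trans (by omega)
    · refine ⟨1, 0, by omega, fun _ _ => rfl, fun i hi => ?_⟩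
      have : ¬ p i := fun h => hp ⟨i, hi, h⟩
      simpa [this] using hi

theorem exists_testBit (p : ℕ → Prop) (m : ℕ) :
    ∃ S : ℕ, S < 2 ^ m ∧ ∀ j : ℕ, S.testBit j = true ↔ j < m ∧ p j := by
  classical
  refine ⟨Nat.ofBits fun i : Fin m => decide (p i), Nat.ofBits_lt_two_pow _, fun j => ?_⟩
  by_cases hj : j < m
  · rw [Nat.testBit_ofBits_lt _ _ hj]
    simp [hj]
  · rw [Nat.testBit_ofBits_ge _ _ (not_lt.1 hj)]
    simp [hj]

theorem testBit_column {R v j : ℕ} :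
    (column R v).testBit j = true ↔ j < v ∧ R.testBit (9 * j + v) = true := by
  have (u : ℕ) : (Nat.rec 0 (fun i c => c ||| ((bit R (9 * i + v)) <<< i)) u : ℕ).testBit j = true
      ↔ j < u ∧ R.testBit (9 * j + v) = true := by
    induction u with
    | zero => simp
    | succ u ih =>
      have : (bit R (9 * u + v) <<< u).testBit j = true ↔
          j = u ∧ R.testBit (9 * u + v) = true := by
        rw [bit_eq]
        cases R.testBit (9 * u + v)
        · simp
        · simp [Nat.shiftLeft_eq, Nat.testBit_two_pow, eq_comm]
      rw [Nat.testBit_or, Bool.or_eq_true, ih, this, Nat.lt_succ_iff_lt_or_eq]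
      constructor
      · rintro (h | ⟨rfl, h⟩)
        exacts [⟨Or.inl h.1, h.2⟩, ⟨Or.inr rfl, h⟩]
      · rintro ⟨h | rfl, h'⟩
        exacts [Or.inl ⟨h, h'⟩, Or.inr ⟨rfl, h'⟩]
  exact this v

theorem max2_eq (d : ℕ) : max2 d = max 2 d := by
  unfold max2
  rcases le_or_gt 2 d with h | h
  · rw [Nat.ble_eq_true_of_le h, max_eq_right h, cond_true]
  · rw [Bool.eq_false_iff.2 (mt Nat.le_of_ble_eq_true h.not_ge), max_eq_left h.le, cond_false]

theorem triOK_eq_true {R r d v : ℕ} : triOK R r d v = true ↔ ∀ i < v, r.testBit i = true →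
    r &&& row R i = 0 → d ≠ 2 ∧ popcount (row R i) ≠ 2 := by
  have hb (a b : ℕ) : Nat.beq a b = decide (a = b) := by
    rw [Bool.eq_iff_iff, Nat.beq_eq]
    simp
  unfold triOK
  rw [allBelow_eq_true]
  refine forall₂_congr fun i _ => ?_
  change (cond (Nat.beq (bit r i) 0) true (force (row R i) fun s =>
    cond (Nat.beq (r &&& s) 0) (cond (Nat.beq d 2) false
      (cond (Nat.beq (popcount s) 2) false true)) true)) = true ↔ _
  rw [cond_true_left_eq_true, force_eq, cond_true_right_eq_true, cond_false_left_eq_true,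
    cond_false_left_eq_true, bit_eq]
  simp only [hb]
  cases r.testBit i <;> simp

theorem step_spec {f : ℕ → ℕ → ℕ → ℕ → ℕ → ℕ → Bool} {n v k d₀ tot lv R r d d₀' : ℕ}
    (h : step f n v k d₀ tot lv R r = true) (hd : popcount r = d)
    (hd₀ : (if v = 0 then d else d₀) = d₀') (hle : d₀' ≤ d)
    (hlv : (if d ≤ 1 then lv + 1 else lv) ≤ 2)
    (htot : tot + max 2 d + n * max 2 d₀' ≤ if d₀' ≤ 1 then 24 else 22)
    (htri : triOK R r d v = true) :
    f (v + 1) k d₀' (tot + max 2 d) (if d ≤ 1 then lv + 1 else lv) (R ||| r <<< (9 * v)) =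
      true := by
  have hb (a b : ℕ) : Nat.beq a b = decide (a = b) := by
    rw [Bool.eq_iff_iff, Nat.beq_eq]
    simp
  have hb' (a b : ℕ) : Nat.ble a b = decide (a ≤ b) := by
    rw [Bool.eq_iff_iff, Nat.ble_eq]
    simp
  unfold step stepD stepD0 stepLv stepTot at h
  simp only [force_eq, hd, hb, hb', max2_eq, Bool.cond_decide, hd₀, Nat.add_eq, Nat.mul_eq] at h
  rw [if_pos hle, if_pos hlv, if_pos htot, htri] at h
  exact h

theorem search_succ {f : ℕ → ℕ → ℕ → ℕ → ℕ → ℕ → Bool} {n v k d₀ tot lv R t S : ℕ}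
    (h : search f (n + 1) v k d₀ tot lv R = true)
    (hvk : v ≠ k) (ht : t < 10 - k) (hS : S < 2 ^ (k - (v + 1))) :
    step (search f n) (8 - v) v (k + t) d₀ tot lv R
      (column R v ||| ((2 ^ t - 1) <<< k) ||| (S <<< (v + 1))) = true := by
  have hb : Nat.beq v k = false := Bool.eq_false_iff.2 (mt Nat.eq_of_beq_eq_true hvk)
  have h : cond (Nat.beq v k) true (force (column R v) fun low => force (8 - v) fun m =>
    allBelow (10 - k) fun t =>
    force (k + t) fun k' => force (low ||| ((2 ^ t - 1) <<< k)) fun low' =>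
    allBelow (2 ^ (k - (v + 1))) fun S => force (low' ||| (S <<< (v + 1)))
      (step (search f n) m v k' d₀ tot lv R)) = true := h
  simp only [hb, cond_false, force_eq, allBelow_eq_true] at h
  exact h t ht S hS

theorem sum_filter_lt_succ (f : Fin 9 → ℕ) {v : ℕ} (hv : v < 9) :
    ∑ i with i.val < v + 1, f i = (∑ i with i.val < v, f i) + f ⟨v, hv⟩ := by
  have : (Finset.univ.filter fun i : Fin 9 => i.val < v + 1) =
      insert ⟨v, hv⟩ (Finset.univ.filter fun i : Fin 9 => i.val < v) := by
    ext i
    simp [Fin.ext_iff]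
    omega
  rw [this, Finset.sum_insert (by simp), add_comm]

/-- The state of the search after the rows of the vertices below `v` have been fixed: the
vertices below `k` are those adjacent to a vertex below `v`, together with `0`. -/
structure Reached (H : SimpleGraph (Fin 9)) (v k d₀ tot lv R : ℕ) : Prop where
  min_zero : ∀ i, (H.neighborSet 0).ncard ≤ (H.neighborSet i).ncard
  one_le : 1 ≤ k
  le : v ≤ k
  le_nine : k ≤ 9
  not_adj : ∀ i j : Fin 9, i.val < v → k ≤ j.val → ¬ H.Adj i j
  codes : Codes R v H
  degree_zero : v ≠ 0 → d₀ = (H.neighborSet 0).ncard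
  tot_eq : tot = ∑ i with i.val < v, max 2 (H.neighborSet i).ncard
  lv_eq : lv = ∑ i with i.val < v, if (H.neighborSet i).ncard ≤ 1 then 1 else 0

theorem Equiv.Perm.le_apply_of_fixes {σ : Equiv.Perm (Fin 9)} {k : ℕ}
    (hσ : ∀ i : Fin 9, i.val < k → σ i = i) {i : Fin 9} (hi : k ≤ i.val) : k ≤ (σ i).val := by
  by_contra! h
  have := σ.injective (hσ _ h)
  rw [this] at h
  omega

theorem Reached.comap {H : SimpleGraph (Fin 9)} {v k d₀ tot lv R : ℕ}
    (h : Reached H v k d₀ tot lv R) {σ : Equiv.Perm (Fin 9)}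
    (hσ : ∀ i : Fin 9, i.val < k → σ i = i) : Reached (H.comap σ) v k d₀ tot lv R := by
  have h0 : σ 0 = 0 := hσ 0 h.one_le
  have hσ' (i : Fin 9) (hi : i.val < v) : σ i = i := hσ i (hi.trans_le h.le)
  refine ⟨?_, h.one_le, h.le, h.le_nine, ?_, ?_, ?_, ?_, ?_⟩
  · simp only [ncard_neighborSet_comap, h0]
    exact fun i => h.min_zero _
  · intro i j hi hj
    rw [SimpleGraph.comap_adj, hσ' i hi]
    exact h.not_adj i _ hi (Equiv.Perm.le_apply_of_fixes hσ hj)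
  · intro i j hj
    rw [h.codes i j hj]
    refine and_congr_right fun hi => ?_
    have hi9 : i < 9 := hi.trans_le (h.le.trans h.le_nine)
    rw [← Fin.val_mk hi9, ← Fin.val_mk hj, adjNat_val, adjNat_val, SimpleGraph.comap_adj,
      hσ' _ hi]
    rcases lt_or_ge j k with hjk | hjk
    · rw [hσ _ hjk]
    · exact iff_of_false (h.not_adj _ _ hi hjk)
        (h.not_adj _ _ hi (Equiv.Perm.le_apply_of_fixes hσ hjk))
  · rw [ncard_neighborSet_comap, h0]
    exact h.degree_zero
  · rw [h.tot_eq]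
    refine Finset.sum_congr rfl fun i hi => ?_
    rw [ncard_neighborSet_comap, hσ' i (by simpa using hi)]
  · rw [h.lv_eq]
    refine Finset.sum_congr rfl fun i hi => ?_
    rw [ncard_neighborSet_comap, hσ' i (by simpa using hi)]

theorem testBit_row_candidate {H : SimpleGraph (Fin 9)} {R v k t S : ℕ} (hR : Codes R v H)
    (hv : v < 9) (hvk : v < k) (hk : k + t ≤ 9)
    (hS : ∀ j, S.testBit j = true ↔ j < k - (v + 1) ∧ AdjNat H v (v + 1 + j))
    (ht : ∀ j : Fin 9, k ≤ j.val → (H.Adj ⟨v, hv⟩ j ↔ j.val < k + t)) (j : ℕ) :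
    (column R v ||| ((2 ^ t - 1) <<< k) ||| (S <<< (v + 1))).testBit j = true ↔
      AdjNat H v j := by
  simp only [Nat.testBit_or, Bool.or_eq_true, testBit_column, Nat.testBit_shiftLeft,
    Nat.testBit_two_pow_sub_one, Bool.and_eq_true, decide_eq_true_eq, hS]
  rcases lt_trichotomy j v with h | rfl | h
  · rw [hR j v hv]
    have h₁ : ¬ k ≤ j := by omega
    have h₂ : ¬ v + 1 ≤ j := by omega
    simp only [h, h₁, h₂, true_and, false_and, or_false]
    exact ⟨AdjNat.symm, AdjNat.symm⟩
  · have h₁ : ¬ k ≤ j := by omega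
    have h₂ : ¬ j + 1 ≤ j := by omega
    simp only [lt_irrefl, h₁, h₂, false_and, or_false, false_iff]
    exact fun h => h.ne rfl
  · rcases lt_or_ge j k with hjk | hjk
    · have h₁ : j - (v + 1) < k - (v + 1) := by omega
      rw [show v + 1 + (j - (v + 1)) = j by omega]
      simp [h.not_gt, hjk.not_ge, h₁, Nat.succ_le_iff.2 h]
    · have h₁ : ¬ j - (v + 1) < k - (v + 1) := by omega
      simp only [h.not_gt, h₁, hjk, true_and, false_and, and_false, false_or, or_false, ge_iff_le]
      constructor
      · intro hj
        have hj9 : j < 9 := by omega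
        exact ⟨hv, hj9, (ht ⟨j, hj9⟩ hjk).2 (by simp; omega)⟩
      · rintro ⟨_, hj9, hadj⟩
        have := (ht ⟨j, hj9⟩ hjk).1 hadj
        simp at this
        omega

theorem Codes.succ {H : SimpleGraph (Fin 9)} {R v r : ℕ} (hR : Codes R v H)
    (hr : ∀ j, r.testBit j = true ↔ AdjNat H v j) : Codes (R ||| r <<< (9 * v)) (v + 1) H := by
  intro i j hj
  simp only [Nat.testBit_or, Bool.or_eq_true, Nat.testBit_shiftLeft, Bool.and_eq_true,
    decide_eq_true_eq, hr, hR i j hj]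
  rcases lt_trichotomy i v with h | rfl | h
  · have h₁ : ¬ 9 * i + j ≥ 9 * v := by omega
    simp [h, h₁, h.trans (Nat.lt_succ_self v)]
  · simp
  · have h₁ : ¬ i < v + 1 := by omega
    simp only [h.not_gt, h₁, false_and, false_or, iff_false, not_and]
    rintro - ⟨-, h₂, -⟩
    omega

theorem triOK_of_testBit {H : SimpleGraph (Fin 9)} (hH : MaxNontraceable H) {R v r : ℕ}
    (hv : v < 9) (hR : Codes R v H) (hr : ∀ j, r.testBit j = true ↔ AdjNat H v j) :
    triOK R r (H.neighborSet ⟨v, hv⟩).ncard v = true := by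
  rw [triOK_eq_true]
  intro i hi hri h0
  have hi9 : i < 9 := hi.trans hv
  have hadj : H.Adj ⟨v, hv⟩ ⟨i, hi9⟩ := adjNat_val.1 ((hr i).1 hri)
  have key (c : Fin 9) (hvc : H.Adj ⟨v, hv⟩ c) (hic : H.Adj ⟨i, hi9⟩ c) : False := by
    have : (r &&& row R i).testBit c = true := by
      rw [Nat.testBit_and, (hr c).2 (adjNat_val.2 hvc),
        hR.testBit_row.2 ⟨hi, (adjNat_val (i := ⟨i, hi9⟩)).2 hic⟩, Bool.and_self]
    simp [h0] at this
  constructor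
  · intro hd
    obtain ⟨c, h₁, h₂⟩ := hH.exists_common_neighbor hadj hd
    exact key c h₁ h₂
  · intro hd
    rw [hR.popcount_row (i := ⟨i, hi9⟩) hi] at hd
    obtain ⟨c, h₁, h₂⟩ := hH.exists_common_neighbor hadj.symm hd
    exact key c h₂ h₁

theorem add_mul_le_sum (f : Fin 9 → ℕ) {n v m : ℕ} (hn : n + v = 9) (hm : ∀ i, m ≤ f i) :
    (∑ i with i.val < v, f i) + n * m ≤ ∑ i, f i := by
  rw [← Finset.sum_filter_add_sum_filter_not Finset.univ (fun i : Fin 9 => i.val < v) f]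
  have hcard : (Finset.univ.filter fun i : Fin 9 => ¬ i.val < v).card = n := by
    have : ∀ v < 10, (Finset.univ.filter fun i : Fin 9 => ¬ i.val < v).card = 9 - v := by decide
    rw [this v (by omega)]
    omega
  have := Finset.card_nsmul_le_sum (Finset.univ.filter fun i : Fin 9 => ¬ i.val < v) f m
    fun i _ => hm i
  rw [hcard, smul_eq_mul] at this
  exact Nat.add_le_add_left this _

/-- The search follows every sparse maximal nontraceable graph, up to relabelling: whatever
the leaf test `f` is, it succeeds at the state which such a graph reaches. -/
theorem exists_reached_of_search {n v k d₀ tot lv R : ℕ} (hnv : v + n ≤ 9)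
    {H : SimpleGraph (Fin 9)} (hH : SparseMNT H) (h : Reached H v k d₀ tot lv R) :
    ∃ H' k' d₀' tot' lv' R', SparseMNT H' ∧ Reached H' (v + n) k' d₀' tot' lv' R' ∧
      ∀ f, search f n v k d₀ tot lv R = true → f (v + n) k' d₀' tot' lv' R' = true := by
  induction n generalizing v k d₀ tot lv R H with
  | zero => exact ⟨H, k, d₀, tot, lv, R, hH, h, fun f hf => hf⟩
  | succ n ih =>
    have hv : v < 9 := by omega
    have hvk : v < k := by
      refine lt_of_le_of_ne h.le fun hvk => ?_
      obtain ⟨i, hi, j, hj, hij⟩ := hH.exists_adj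
        (T := Finset.univ.filter fun i => i.val < v) (a := 0) (b := ⟨v, hv⟩)
        (by simpa using hvk ▸ h.one_le) (by simp)
      simp only [Finset.mem_filter, Finset.mem_univ, true_and, not_lt] at hi hj
      exact h.not_adj i j hi (hvk ▸ hj) hij
    obtain ⟨σ, t, ht, hσ, hσt⟩ := exists_perm_initial (H.Adj ⟨v, hv⟩) h.le_nine
    replace h := h.comap hσ
    replace hH := hH.comap σ
    have hσv : σ ⟨v, hv⟩ = ⟨v, hv⟩ := hσ _ hvk
    have hadj : ∀ j : Fin 9, k ≤ j.val → ((H.comap σ).Adj ⟨v, hv⟩ j ↔ j.val < k + t) := by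
      intro j hj
      rw [SimpleGraph.comap_adj, hσv]
      exact hσt j hj
    generalize H.comap σ = H at h hH hadj
    obtain ⟨S, hS, hSbit⟩ := exists_testBit (fun j => AdjNat H v (v + 1 + j)) (k - (v + 1))
    have hstep := fun f hf => search_succ (f := f) (n := n) (d₀ := d₀) (tot := tot) (lv := lv)
      (R := R) hf hvk.ne (t := t) (by omega) hS
    have hr := testBit_row_candidate h.codes hv hvk ht hSbit hadj
    generalize column R v ||| ((2 ^ t - 1) <<< k) ||| (S <<< (v + 1)) = r at hr hstep
    have hr512 : r < 2 ^ 9 := Nat.lt_pow_two_of_testBit r fun j hj => by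
      rw [Bool.eq_false_iff, Ne, hr]
      rintro ⟨-, h₂, -⟩
      omega
    have hd : popcount r = (H.neighborSet ⟨v, hv⟩).ncard := popcount_eq_ncard hr512 hr
    have hd₀ : (if v = 0 then (H.neighborSet ⟨v, hv⟩).ncard else d₀) =
        (H.neighborSet 0).ncard := by
      split_ifs with hv0
      · subst hv0
        rfl
      · exact h.degree_zero hv0
    have htot := sum_filter_lt_succ (fun i => max 2 (H.neighborSet i).ncard) hv
    rw [← h.tot_eq] at htot
    have hlv := sum_filter_lt_succ (fun i => if (H.neighborSet i).ncard ≤ 1 then 1 else 0) hv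
    rw [← h.lv_eq] at hlv
    have hlv' : (if (H.neighborSet ⟨v, hv⟩).ncard ≤ 1 then lv + 1 else lv) =
        ∑ i with i.val < v + 1, if (H.neighborSet i).ncard ≤ 1 then 1 else 0 := by
      rw [hlv]
      split_ifs <;> rfl
    have hleaves : (if (H.neighborSet ⟨v, hv⟩).ncard ≤ 1 then lv + 1 else lv) ≤ 2 := by
      have := hH.card_leaves_le
      rw [Finset.card_filter] at this
      exact hlv' ▸ (Finset.sum_le_univ_sum_of_nonneg fun i => Nat.zero_le _).trans this
    have hsum : tot + max 2 (H.neighborSet ⟨v, hv⟩).ncard +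
        (8 - v) * max 2 (H.neighborSet 0).ncard ≤
        if (H.neighborSet 0).ncard ≤ 1 then 24 else 22 := by
      rw [← htot]
      exact (add_mul_le_sum _ (by omega) fun i => max_le_max le_rfl (h.min_zero i)).trans
        (hH.sum_max_le h.min_zero)
    have htri := triOK_of_testBit hH.1 hv h.codes hr
    have hnot : ∀ i j : Fin 9, i.val < v + 1 → k + t ≤ j.val → ¬ H.Adj i j := by
      intro i j hi hj
      rcases Nat.lt_succ_iff_lt_or_eq.1 hi with hi | hi
      · exact h.not_adj i j hi (by omega)
      · obtain rfl : i = ⟨v, hv⟩ := Fin.ext hi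
        rw [hadj j (by omega)]
        omega
    obtain ⟨H', k', d₀', tot', lv', R', hH', h', hf'⟩ := ih (v := v + 1) (by omega) hH
      ⟨h.min_zero, h.one_le.trans (by omega), by omega, ht, hnot, h.codes.succ hr, fun _ => rfl,
        htot.symm, hlv'⟩
    rw [add_right_comm, add_assoc] at h' hf'
    exact ⟨H', k', d₀', tot', lv', R', hH', h', fun f hf =>
      hf' f (step_spec (hstep f hf) hd hd₀ (h.min_zero _) hleaves hsum htri)⟩

set_option maxHeartbeats 0 in
theorem search_searchPart {i : ℕ} (hi : i < 23) : search (searchPart i) 3 0 1 0 0 0 0 = true := by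
  interval_cases i <;> decide +kernel

theorem SparseMNT.false_of_min_zero {H : SimpleGraph (Fin 9)} (hH : SparseMNT H)
    (hmin : ∀ i, (H.neighborSet 0).ncard ≤ (H.neighborSet i).ncard) : False := by
  have hstart : Reached H 0 1 0 0 0 0 := ⟨hmin, le_rfl, Nat.zero_le 1, by norm_num,
    fun i j hi => absurd hi (Nat.not_lt_zero _), fun i j _ => by simp,
    fun h => absurd rfl h, by simp, by simp⟩
  obtain ⟨H₁, k₁, d₁, tot₁, lv₁, R₁, hH₁, h₁, hf₁⟩ :=
    exists_reached_of_search (n := 3) (by norm_num) hH hstart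
  have hs := hf₁ _ (search_searchPart (Nat.mod_lt R₁ (by norm_num : 23 > 0)))
  unfold searchPart at hs
  rw [show Nat.beq (Nat.mod R₁ 23) (R₁ % 23) = true by rw [Nat.beq_eq]; rfl, cond_true] at hs
  obtain ⟨H₂, k₂, d₂, tot₂, lv₂, R₂, hH₂, h₂, hf₂⟩ :=
    exists_reached_of_search (n := 6) (by norm_num) hH₁ h₁
  exact h₂.codes.not_maxNontraceable (hf₂ _ hs) hH₂.1

theorem sum_ncard_neighborSet {V : Type*} [Fintype V] (G : SimpleGraph V) :
    ∑ i, (G.neighborSet i).ncard = 2 * Nat.card G.edgeSet := by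
  classical
  rw [Nat.card_eq_fintype_card, ← SimpleGraph.edgeFinset_card,
    ← SimpleGraph.sum_degrees_eq_twice_card_edges]
  refine Finset.sum_congr rfl fun i _ => ?_
  rw [← SimpleGraph.card_neighborSet_eq_degree, ← Nat.card_coe_set_eq, Nat.card_eq_fintype_card]

theorem MaxNontraceable.twelve_le_card_edgeSet {G : SimpleGraph (Fin 9)}
    (hG : MaxNontraceable G) : 12 ≤ Nat.card G.edgeSet := by
  by_contra! hlt
  have hH : SparseMNT G := ⟨hG, by rw [sum_ncard_neighborSet]; omega⟩
  obtain ⟨x, hx⟩ := Finite.exists_min fun i => (G.neighborSet i).ncard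
  refine (hH.comap (Equiv.swap 0 x)).false_of_min_zero fun i => ?_
  rw [ncard_neighborSet_comap, ncard_neighborSet_comap, Equiv.swap_apply_left]
  exact hx _

/-- A triangle together with three pendant triangles, one attached at each of its vertices. -/
def triangleOfTriangles : SimpleGraph (Fin 9) :=
  SimpleGraph.fromRel fun i j => ∃ T ∈ ({{0, 1, 2}, {0, 3, 4}, {1, 5, 6}, {2, 7, 8}} :
    Finset (Finset (Fin 9))), i ∈ T ∧ j ∈ T

instance : DecidableRel triangleOfTriangles.Adj := fun i j =>
  inferInstanceAs (Decidable (i ≠ j ∧ (_ ∨ _)))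

theorem codes_triangleOfTriangles : Codes 625751067280714148661790 9 triangleOfTriangles := by
  have h : ∀ i j : Fin 9, Nat.testBit 625751067280714148661790 (9 * i + j) = true ↔
      triangleOfTriangles.Adj i j := by decide +kernel
  intro i j hj
  by_cases hi : i < 9
  · simpa [hi] using (h ⟨i, hi⟩ ⟨j, hj⟩).trans adjNat_val.symm
  · refine iff_of_false ?_ fun h => hi h.1
    rw [Nat.testBit_lt_two_pow]
    · simp
    · exact lt_of_lt_of_le (by norm_num : _ < 2 ^ 81)
        (Nat.pow_le_pow_right two_pos (by omega))

theorem maxNontraceable_triangleOfTriangles : MaxNontraceable triangleOfTriangles := by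
  have hadd : ∀ u w : Fin 9, u ≠ w → ¬ triangleOfTriangles.Adj u w →
      hasHam (addEdge 625751067280714148661790 u w) = true := by decide +kernel
  have hnot : hasHam 625751067280714148661790 = false := by decide +kernel
  exact ⟨fun h => Bool.eq_false_iff.1 hnot (codes_triangleOfTriangles.hasHam_eq_true.2 h),
    fun u w huw hadj => (codes_triangleOfTriangles.addEdge huw).hasHam_eq_true.1
      (hadd u w huw hadj)⟩

theorem card_edgeSet_triangleOfTriangles : Nat.card triangleOfTriangles.edgeSet = 12 := by
  rw [Nat.card_eq_fintype_card, ← SimpleGraph.edgeFinset_card]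
  have h : ∑ i, triangleOfTriangles.degree i = 24 := by decide +kernel
  rw [SimpleGraph.sum_degrees_eq_twice_card_edges] at h
  omega

/-- Every MNT graph of order 9 has at least 12 edges, and some MNT graph of
order 9 has exactly 12 edges. -/
theorem stmt_11 :
    (∀ G : SimpleGraph (Fin 9), MaxNontraceable G → 12 ≤ Nat.card G.edgeSet) ∧
    (∃ G : SimpleGraph (Fin 9), MaxNontraceable G ∧ Nat.card G.edgeSet = 12) :=
  ⟨fun _ hG => hG.twelve_le_card_edgeSet, triangleOfTriangles,
    maxNontraceable_triangleOfTriangles, card_edgeSet_triangleOfTriangles⟩
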